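/- For all z_1, z_2, z_3 ∈ ℂ, γ ∈ ℂ and λ ∈ ℂ^N at which all theta-function denominators occurring in the factors are nonzero, the elliptic dynamical R-matrix satisfies the dynamical Yang–Baxter equation on ℂ^N ⊗ ℂ^N ⊗ ℂ^N: R(z_1−z_2, λ−γh^{(3)})^{(12)} R(z_1−z_3, λ)^{(13)} R(z_2−z_3, λ−γh^{(1)})^{(23)} = R(z_2−z_3, λ)^{(23)} R(z_1−z_3, λ−γh^{(2)})^{(13)} R(z_1−z_2, λ)^{(12)}. -/

import Mathlib

open scoped BigOperators
open Complex Matrix Filter Topology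

noncomputable section

namespace EllipticQG

/-- Jacobi's first theta function `θ(z) = -∑_{j ∈ ℤ+1/2} e^{πij²τ + 2πij(z+1/2)}`. -/
def theta (τ z : ℂ) : ℂ :=
  -∑' j : ℤ, Complex.exp ((Real.pi : ℂ) * Complex.I * ((j : ℂ) + 1 / 2) ^ 2 * τ +
      2 * (Real.pi : ℂ) * Complex.I * ((j : ℂ) + 1 / 2) * (z + 1 / 2))

/-- `α(z,μ) = θ(z)θ(μ+γ)/(θ(z-γ)θ(μ))`. -/
def alphaF (τ γ z μ : ℂ) : ℂ :=
  theta τ z * theta τ (μ + γ) / (theta τ (z - γ) * theta τ μ)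

/-- `β(z,μ) = -θ(z+μ)θ(γ)/(θ(z-γ)θ(μ))`. -/
def betaF (τ γ z μ : ℂ) : ℂ :=
  -(theta τ (z + μ) * theta τ γ) / (theta τ (z - γ) * theta τ μ)

/-- The elliptic dynamical R-matrix of `E_{τ,γ/2}(gl_N)` on `ℂ^N ⊗ ℂ^N`.
Entry `((i,j),(k,l))` is the coefficient of `e_i ⊗ e_j` in `R (e_k ⊗ e_l)`. -/
def Rmat (N : ℕ) (τ γ z : ℂ) (lam : Fin N → ℂ) :
    Matrix (Fin N × Fin N) (Fin N × Fin N) ℂ := fun p q =>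
  if p.1 = p.2 then (if q = p then 1 else 0)
  else (if q = p then alphaF τ γ z (lam p.1 - lam p.2) else 0) +
    (if q = (p.2, p.1) then betaF τ γ z (lam p.1 - lam p.2) else 0)

/-- `λ - γ ∑_{c ∈ S} h^{(c)}` evaluated on the configuration `g` of basis indices. -/
def shiftL {n N : ℕ} (γ : ℂ) (lam : Fin N → ℂ) (S : Finset (Fin n)) (g : Fin n → Fin N) :
    Fin N → ℂ :=
  fun i => lam i - γ * ((S.filter fun c => g c = i).card : ℂ)

/-- `R(z, λ - γ ∑_{c∈S} h^{(c)})^{(a b)}` acting on `(ℂ^N)^{⊗ n}`. -/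
def Rop (N n : ℕ) (τ γ z : ℂ) (lam : Fin N → ℂ) (S : Finset (Fin n)) (a b : Fin n) :
    Matrix (Fin n → Fin N) (Fin n → Fin N) ℂ := fun f g =>
  if ∀ c, c ≠ a → c ≠ b → f c = g c then
    Rmat N τ γ z (shiftL γ lam S g) (f a, f b) (g a, g b)
  else 0

/-- The operators `W_n(z,λ)`, defined recursively:  `W_1 = 1` and
`W_{n+1}(z,λ) = R(z_1-z_2, λ-γ∑_{j=3}^{n+1}h^{(j)})^{(12)} ⋯ R(z_1-z_{n+1},λ)^{(1 n+1)}
  (1 ⊗ W_n(z_2,…,z_{n+1}, λ-γh^{(1)}))` (tensor factors indexed `0,…,n`). -/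
def Wrec (N : ℕ) (τ γ : ℂ) : (n : ℕ) → (Fin n → ℂ) → (Fin N → ℂ) →
    Matrix (Fin n → Fin N) (Fin n → Fin N) ℂ
  | 0, _, _ => 1
  | n + 1, z, lam =>
    (((List.finRange n).map fun j : Fin n =>
      Rop N (n + 1) τ γ (z 0 - z j.succ) lam
        (Finset.univ.filter fun c : Fin (n + 1) => j.succ < c) 0 j.succ).prod) *
      Matrix.of (fun f g : Fin (n + 1) → Fin N =>
        if f 0 = g 0 then
          Wrec N τ γ n (fun j => z j.succ) (fun i => lam i - if g 0 = i then γ else 0)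
            (Fin.tail f) (Fin.tail g)
        else 0)

/-- `W^S_n(λ) = W_n(z^S, λ)` with `z^S = (0, γ, 2γ, …, (n-1)γ)`. -/
def WS (N n : ℕ) (τ γ : ℂ) (lam : Fin N → ℂ) :
    Matrix (Fin n → Fin N) (Fin n → Fin N) ℂ :=
  Wrec N τ γ n (fun j => ((j : ℕ) : ℂ) * γ) lam

/-- `z^∧ = ((n-1)γ, …, 2γ, γ, 0)`. -/
def zWedge (n : ℕ) (γ : ℂ) : Fin n → ℂ := fun j => ((n - 1 - (j : ℕ) : ℕ) : ℂ) * γ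

/-- `W^∧_n(λ) = lim_{z → z^∧} ∏_{j=1}^{n-1} (z_j - z_{j+1} - γ) · ρ W_n(z,λ) ρ`,
where `ρ` reverses the order of the tensor factors. -/
def Wwedge (N n : ℕ) (τ γ : ℂ) (lam : Fin N → ℂ) :
    Matrix (Fin n → Fin N) (Fin n → Fin N) ℂ :=
  limUnder (𝓝[≠] zWedge n γ) fun z : Fin n → ℂ =>
    (∏ j : Fin n, if h : (j : ℕ) + 1 < n then z j - z ⟨(j : ℕ) + 1, h⟩ - γ else 1) •
      Matrix.of fun f g : Fin n → Fin N => Wrec N τ γ n z lam (f ∘ Fin.rev) (g ∘ Fin.rev)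

/-- The space `S²(ℂ^N)` of symmetric tensors in `ℂ^N ⊗ ℂ^N`. -/
def symPair (N : ℕ) : Submodule ℂ ((Fin N × Fin N) → ℂ) where
  carrier := {v | ∀ p : Fin N × Fin N, v p = v (p.2, p.1)}
  add_mem' := by intro a b ha hb p; simp only [Pi.add_apply, ha p, hb p]
  zero_mem' := by intro p; rfl
  smul_mem' := by intro c v hv p; simp only [Pi.smul_apply, hv p]

/-- `R^{reg}(γ,λ) = lim_{z→γ} (z-γ) R(z,λ)`. -/
def Rreg (N : ℕ) (τ γ : ℂ) (lam : Fin N → ℂ) : Matrix (Fin N × Fin N) (Fin N × Fin N) ℂ :=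
  limUnder (𝓝[≠] γ) fun z : ℂ => (z - γ) • Rmat N τ γ z lam

/-- The flip `P : u ⊗ v ↦ v ⊗ u` on `ℂ^N ⊗ ℂ^N`. -/
def Pmat (N : ℕ) : Matrix (Fin N × Fin N) (Fin N × Fin N) ℂ := fun p q =>
  if q = (p.2, p.1) then 1 else 0

/-- The space `S^n(ℂ^N)` of symmetric tensors in `(ℂ^N)^{⊗n}`. -/
def symTensors (N n : ℕ) : Submodule ℂ ((Fin n → Fin N) → ℂ) where
  carrier := {v | ∀ (σ : Equiv.Perm (Fin n)) (f : Fin n → Fin N), v (f ∘ σ) = v f}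
  add_mem' := by intro a b ha hb σ f; simp only [Pi.add_apply, ha σ f, hb σ f]
  zero_mem' := by intro σ f; rfl
  smul_mem' := by intro c v hv σ f; simp only [Pi.smul_apply, hv σ f]

/-- `J_n(ℂ^N)`: the span of tensors `σ v - sign(σ) v`. -/
def Jspan (N n : ℕ) : Submodule ℂ ((Fin n → Fin N) → ℂ) :=
  Submodule.span ℂ {w | ∃ (σ : Equiv.Perm (Fin n)) (v : (Fin n → Fin N) → ℂ),
    w = (fun f => v (f ∘ σ)) - ((Equiv.Perm.sign σ : ℤ) : ℂ) • v}

/-- `ℂ^N ⊗ W ⊆ ℂ^N ⊗ (ℂ^N)^{⊗ n}` for a subspace `W ⊆ (ℂ^N)^{⊗ n}`. -/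
def consSlice (N n : ℕ) (W : Submodule ℂ ((Fin n → Fin N) → ℂ)) :
    Submodule ℂ ((Fin (n + 1) → Fin N) → ℂ) where
  carrier := {v | ∀ i : Fin N, (fun g : Fin n → Fin N => v (Fin.cons i g)) ∈ W}
  add_mem' := by intro a b ha hb i; exact W.add_mem (ha i) (hb i)
  zero_mem' := by intro i; exact W.zero_mem
  smul_mem' := by intro c v hv i; exact W.smul_mem c (hv i)

/-- The `L`-operator of `V^{⊗n}(w)`:
`L(z,λ) = R(z-w, λ-γ∑_{j=2}^n h^{(j)})^{(01)} ⋯ R(z-w-γ(n-1), λ)^{(0n)}`,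
acting on `ℂ^N ⊗ (ℂ^N)^{⊗n}` with factors numbered `0,…,n`. -/
def Lop (N n : ℕ) (τ γ z w : ℂ) (lam : Fin N → ℂ) :
    Matrix (Fin (n + 1) → Fin N) (Fin (n + 1) → Fin N) ℂ :=
  ((List.finRange n).map fun j : Fin n =>
    Rop N (n + 1) τ γ (z - w - (j : ℕ) * γ) lam
      (Finset.univ.filter fun c : Fin (n + 1) => j.succ < c) 0 j.succ).prod

/-- The `L`-operator for the opposite coproduct:
`L'(z,λ) = R(z-w-γ(n-1), λ-γ∑_{j=1}^{n-1} h^{(j)})^{(0n)} ⋯ R(z-w, λ)^{(01)}`. -/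
def Lop' (N n : ℕ) (τ γ z w : ℂ) (lam : Fin N → ℂ) :
    Matrix (Fin (n + 1) → Fin N) (Fin (n + 1) → Fin N) ℂ :=
  (((List.finRange n).reverse).map fun j : Fin n =>
    Rop N (n + 1) τ γ (z - w - (j : ℕ) * γ) lam
      (Finset.univ.filter fun c : Fin (n + 1) => 0 < c ∧ c < j.succ) 0 j.succ).prod

/-- `Id ⊗ M` on `ℂ^N ⊗ (ℂ^N)^{⊗n}`. -/
def idTensor (N n : ℕ) (M : Matrix (Fin n → Fin N) (Fin n → Fin N) ℂ) :
    Matrix (Fin (n + 1) → Fin N) (Fin (n + 1) → Fin N) ℂ :=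
  Matrix.of fun f g => if f 0 = g 0 then M (Fin.tail f) (Fin.tail g) else 0

/-- `Id ⊗ M(λ - γ h^{(0)})` on `ℂ^N ⊗ (ℂ^N)^{⊗n}`. -/
def idTensorShift (N n : ℕ) (γ : ℂ)
    (M : (Fin N → ℂ) → Matrix (Fin n → Fin N) (Fin n → Fin N) ℂ) (lam : Fin N → ℂ) :
    Matrix (Fin (n + 1) → Fin N) (Fin (n + 1) → Fin N) ℂ :=
  Matrix.of fun f g =>
    if f 0 = g 0 then M (fun i => lam i - if g 0 = i then γ else 0) (Fin.tail f) (Fin.tail g)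
    else 0

/-- The zero-weight symmetric tensor `e`: the sum of all `e_{i_1} ⊗ ⋯ ⊗ e_{i_n}` over
sequences in which each index occurs exactly `ℓ` times. -/
def evec (N n ℓ : ℕ) : (Fin n → Fin N) → ℂ := fun f =>
  if ∀ i : Fin N, (Finset.univ.filter fun j => f j = i).card = ℓ then 1 else 0

/-- The multi-index of `ē = e_1^{⊗ℓ} ⊗ ⋯ ⊗ e_N^{⊗ℓ}`. -/
def barIdx (N ℓ : ℕ) : Fin (N * ℓ) → Fin N := fun j =>
  ⟨j.val / ℓ, by
    have h : (j : ℕ) < ℓ * N := by rw [Nat.mul_comm ℓ N]; exact j.isLt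
    exact Nat.div_lt_of_lt_mul h⟩

/-- `g_{N,ℓ}(λ) = ∏_{1≤j<k≤N} ∏_{s=1}^ℓ θ(λ_j-λ_k+γs)/θ(λ_j-λ_k-γ(s-1))`. -/
def gfun (N ℓ : ℕ) (τ γ : ℂ) (lam : Fin N → ℂ) : ℂ :=
  ∏ j : Fin N, ∏ k : Fin N,
    if j < k then
      ∏ s ∈ Finset.Icc 1 ℓ,
        theta τ (lam j - lam k + γ * (s : ℂ)) / theta τ (lam j - lam k - γ * ((s : ℂ) - 1))
    else 1

/-- The permutation induced by a word in the generators `s_1, …, s_n` of `S_{n+1}`: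
`π_k = s_{a_1} ∘ ⋯ ∘ s_{a_k}` (letters `a` act as the transposition of `a` and `a+1`). -/
def permOfWord {n : ℕ} : List (Fin n) → Equiv.Perm (Fin (n + 1))
  | [] => 1
  | a :: rest => Equiv.swap a.castSucc a.succ * permOfWord rest

/-- The product of R-matrices attached to a word (with accumulated permutation `π`):
`W_w(z,λ) = F_k ⋯ F_1` where for the `t`-th letter `a`
`F_t = R(z_{π(a)} - z_{π(a+1)}, λ - γ ∑_{b<a} h^{(π(b))})^{(π(a), π(a+1))}`,
`π = π_{t-1}` the permutation induced by the earlier letters. -/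
def Wword (N : ℕ) {n : ℕ} (τ γ : ℂ) (z : Fin (n + 1) → ℂ) (lam : Fin N → ℂ) :
    List (Fin n) → Equiv.Perm (Fin (n + 1)) →
      Matrix (Fin (n + 1) → Fin N) (Fin (n + 1) → Fin N) ℂ
  | [], _ => 1
  | a :: rest, π =>
      Wword N τ γ z lam rest (π * Equiv.swap a.castSucc a.succ) *
        Rop N (n + 1) τ γ (z (π a.castSucc) - z (π a.succ)) lam
          ((Finset.univ.filter fun c : Fin (n + 1) => (c : ℕ) < (a : ℕ)).image π)
          (π a.castSucc) (π a.succ)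

/-- The fused R-matrix `𝓡_{V^{⊗m}(z), V^{⊗n}(w)}(λ)` on `(ℂ^N)^{⊗(m+n)}`
(first block: factors `0,…,m-1`; second block: factors `m,…,m+n-1`). -/
def Rmn (N m n : ℕ) (τ γ z w : ℂ) (lam : Fin N → ℂ) :
    Matrix (Fin (m + n) → Fin N) (Fin (m + n) → Fin N) ℂ :=
  ((List.finRange m).map fun a : Fin m =>
    ((List.finRange n).map fun j : Fin n =>
      Rop N (m + n) τ γ (z + (a : ℕ) * γ - w - (j : ℕ) * γ) lam
        (Finset.univ.filter fun c : Fin (m + n) =>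
          (c : ℕ) < (a : ℕ) ∨ m + (j : ℕ) < (c : ℕ))
        (Fin.castAdd n a) (Fin.natAdd m j)).prod).prod

/-- `A ⊗ B ⊆ (ℂ^N)^{⊗m} ⊗ (ℂ^N)^{⊗n}`, realised as `(A ⊗ V₂) ∩ (V₁ ⊗ B)`. -/
def blockSub (N m n : ℕ) (A : Submodule ℂ ((Fin m → Fin N) → ℂ))
    (B : Submodule ℂ ((Fin n → Fin N) → ℂ)) :
    Submodule ℂ ((Fin (m + n) → Fin N) → ℂ) where
  carrier := {v |
    (∀ g : Fin n → Fin N, (fun f : Fin m → Fin N => v (Fin.append f g)) ∈ A) ∧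
    ∀ f : Fin m → Fin N, (fun g : Fin n → Fin N => v (Fin.append f g)) ∈ B}
  add_mem' := by
    intro x y hx hy
    exact ⟨fun g => A.add_mem (hx.1 g) (hy.1 g), fun f => B.add_mem (hx.2 f) (hy.2 f)⟩
  zero_mem' := ⟨fun _ => A.zero_mem, fun _ => B.zero_mem⟩
  smul_mem' := by
    intro c x hx
    exact ⟨fun g => A.smul_mem c (hx.1 g), fun f => B.smul_mem c (hx.2 f)⟩

/-- Matrix element `L_{jk}(z,λ)` of the `L`-operator (evaluation point `w = 0`),
as an operator on `(ℂ^N)^{⊗n}`: `L(z,λ)(e_k ⊗ v) = ∑_j e_j ⊗ L_{jk}(z,λ) v`. -/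
def LmatEl (N n : ℕ) (τ γ z : ℂ) (lam : Fin N → ℂ) (j k : Fin N)
    (v : (Fin n → Fin N) → ℂ) : (Fin n → Fin N) → ℂ := fun g =>
  (Lop N n τ γ z 0 lam).mulVec
    (fun f => (if f 0 = k then (1 : ℂ) else 0) * v (Fin.tail f)) (Fin.cons j g)

/-- `L_{j_{σ(1)} j_1}(z, λ-γ(ω_{j_2}+⋯+ω_{j_m})) ∘ ⋯ ∘ L_{j_{σ(m)} j_m}(z-(m-1)γ, λ)`. -/
def chainT (N n m : ℕ) (τ γ z : ℂ) (lam : Fin N → ℂ) (jt : Fin m → Fin N)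
    (σ : Equiv.Perm (Fin m)) (v : (Fin n → Fin N) → ℂ) : (Fin n → Fin N) → ℂ :=
  (List.finRange m).foldr
    (fun (t : Fin m) acc =>
      LmatEl N n τ γ (z - (t.val : ℂ) * γ)
        (fun i => lam i -
          γ * ((Finset.univ.filter fun s : Fin m => t < s ∧ jt s = i).card : ℂ))
        (jt (σ t)) (jt t) acc)
    v

/-- The transfer matrix `T_m(z)`, acting on scalar functions of `λ` via the identification
of the zero weight space of `S^{Nℓ}(ℂ^N)` with `ℂ` by the basis vector `e`:
`T_m(z) f(λ) = ∑_{j_1<⋯<j_m} ∑_{σ} (-1)^σ [L_{j_{σ(1)} j_1}(z,λ-γ(ω_{j_2}+⋯+ω_{j_m})) ⋯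
L_{j_{σ(m)} j_m}(z-(m-1)γ, λ)] e · f(λ-γ(ω_{j_1}+⋯+ω_{j_m}))`. -/
def Tm (N ℓ m : ℕ) (τ γ z : ℂ) (lam : Fin N → ℂ) (f : (Fin N → ℂ) → ℂ) : ℂ :=
  ∑ jt ∈ Finset.univ.filter fun jt : Fin m → Fin N => ∀ s t : Fin m, s < t → jt s < jt t,
    ∑ σ : Equiv.Perm (Fin m),
      ((Equiv.Perm.sign σ : ℤ) : ℂ) *
        chainT N (N * ℓ) m τ γ z lam jt σ (evec N (N * ℓ) ℓ) (barIdx N ℓ) *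
        f fun i => lam i - if ∃ t, jt t = i then γ else 0

/-- The `m`-th Ruijsenaars operator with coupling constant `ℓ`:
`M_m f(λ) = ∑_{|J|=m} ∏_{j∈J,k∉J} θ(λ_j-λ_k+ℓγ)/θ(λ_j-λ_k) · f(λ-γ∑_{j∈J}ω_j)`. -/
def Mm (N ℓ m : ℕ) (τ γ : ℂ) (f : (Fin N → ℂ) → ℂ) (lam : Fin N → ℂ) : ℂ :=
  ∑ J ∈ Finset.powersetCard m (Finset.univ : Finset (Fin N)),
    (∏ j ∈ J, ∏ k ∈ Jᶜ, theta τ (lam j - lam k + (ℓ : ℂ) * γ) / theta τ (lam j - lam k)) *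
      f fun i => lam i - if i ∈ J then γ else 0

/-- The transfer matrix with auxiliary space indexed by `ι` (weights `wt`) and quantum
space indexed by `ι₃`: `T f(λ) = ∑_μ tr_{W[μ]}(𝓡(λ)) f(λ-γμ)`. -/
def transferOp {N : ℕ} {ι ι₃ : Type} [Fintype ι] [Fintype ι₃] (γ : ℂ)
    (wt : ι → Fin N → ℂ) (R : (Fin N → ℂ) → Matrix (ι × ι₃) (ι × ι₃) ℂ)
    (f : (Fin N → ℂ) → ι₃ → ℂ) : (Fin N → ℂ) → ι₃ → ℂ := fun lam b =>
  ∑ a : ι, ∑ b' : ι₃, R lam (a, b) (a, b') * f (fun r => lam r - γ * wt a r) b'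


/-- The general term of the series defining `theta`. -/
def thetaTerm (τ z : ℂ) (j : ℤ) : ℂ :=
  Complex.exp ((Real.pi : ℂ) * Complex.I * ((j : ℂ) + 1 / 2) ^ 2 * τ +
    2 * (Real.pi : ℂ) * Complex.I * ((j : ℂ) + 1 / 2) * (z + 1 / 2))

/-- The general term of the theta series over even integers, with modulus `τ / 2`. -/
def evenTerm (τ x : ℂ) (p : ℤ) : ℂ :=
  Complex.exp ((Real.pi : ℂ) * Complex.I * (2 * (p : ℂ)) ^ 2 * (τ / 2) +
    2 * (Real.pi : ℂ) * Complex.I * (2 * (p : ℂ)) * x)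

/-- The general term of the theta series over odd integers, with modulus `τ / 2`. -/
def oddTerm (τ x : ℂ) (p : ℤ) : ℂ :=
  Complex.exp ((Real.pi : ℂ) * Complex.I * (2 * (p : ℂ) + 1) ^ 2 * (τ / 2) +
    2 * (Real.pi : ℂ) * Complex.I * (2 * (p : ℂ) + 1) * x)

lemma summable_thetaTerm {τ : ℂ} (hτ : 0 < τ.im) (z : ℂ) : Summable (thetaTerm τ z) := by
  refine (((summable_jacobiTheta₂_term_iff (z + 1 / 2 + τ / 2) τ).mpr hτ).mul_left
    (Complex.exp ((Real.pi : ℂ) * Complex.I * τ / 4 +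
      (Real.pi : ℂ) * Complex.I * (z + 1 / 2)))).congr fun j => ?_
  rw [thetaTerm, jacobiTheta₂_term, ← Complex.exp_add]
  ring_nf

lemma summable_evenTerm {τ : ℂ} (hτ : 0 < τ.im) (x : ℂ) : Summable (evenTerm τ x) := by
  have h2 : 0 < (2 * τ).im := by simpa using hτ
  refine ((summable_jacobiTheta₂_term_iff (2 * x) (2 * τ)).mpr h2).congr fun j => ?_
  rw [evenTerm, jacobiTheta₂_term]
  ring_nf

lemma summable_oddTerm {τ : ℂ} (hτ : 0 < τ.im) (x : ℂ) : Summable (oddTerm τ x) := by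
  have h2 : 0 < (2 * τ).im := by simpa using hτ
  refine (((summable_jacobiTheta₂_term_iff (2 * x + τ) (2 * τ)).mpr h2).mul_left
    (Complex.exp ((Real.pi : ℂ) * Complex.I * τ / 2 +
      2 * (Real.pi : ℂ) * Complex.I * x))).congr fun j => ?_
  rw [oddTerm, jacobiTheta₂_term, ← Complex.exp_add]
  ring_nf

/-- Pairs of integers sorted by the parity of their difference. -/
def pairParityEquiv : (ℤ × ℤ) ⊕ (ℤ × ℤ) ≃ ℤ × ℤ where
  toFun := Sum.elim (fun p => (p.1 + p.2, p.1 - p.2 - 1)) (fun p => (p.1 + p.2, p.1 - p.2))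
  invFun p :=
    if (p.1 - p.2) % 2 = 1 then .inl ((p.1 + p.2 + 1) / 2, (p.1 - p.2 - 1) / 2)
    else .inr ((p.1 + p.2) / 2, (p.1 - p.2) / 2)
  left_inv := by
    rintro (⟨p, q⟩ | ⟨p, q⟩)
    · have h : (p + q - (p - q - 1)) % 2 = 1 := by omega
      simp only [Sum.elim_inl, h, if_true, Sum.inl.injEq, Prod.mk.injEq]
      omega
    · have h : ¬ (p + q - (p - q)) % 2 = 1 := by omega
      simp only [Sum.elim_inr, h, if_false, Sum.inr.injEq, Prod.mk.injEq]
      omega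
  right_inv := by
    rintro ⟨j, k⟩
    by_cases h : (j - k) % 2 = 1
    · simp only [h, if_true, Sum.elim_inl, Prod.mk.injEq]
      omega
    · simp only [h, if_false, Sum.elim_inr, Prod.mk.injEq]
      omega

lemma thetaTerm_mul_thetaTerm_inl (τ x y : ℂ) (p q : ℤ) :
    thetaTerm τ (x + y) (p + q) * thetaTerm τ (x - y) (p - q - 1) =
      evenTerm τ x p * oddTerm τ y q := by
  rw [thetaTerm, thetaTerm, evenTerm, oddTerm, ← Complex.exp_add, ← Complex.exp_add,
    Complex.exp_eq_exp_iff_exists_int]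
  refine ⟨p, ?_⟩
  push_cast
  ring

lemma thetaTerm_mul_thetaTerm_inr (τ x y : ℂ) (p q : ℤ) :
    thetaTerm τ (x + y) (p + q) * thetaTerm τ (x - y) (p - q) =
      -(oddTerm τ x p * evenTerm τ y q) := by
  rw [thetaTerm, thetaTerm, evenTerm, oddTerm, ← Complex.exp_add, ← Complex.exp_add,
    neg_eq_neg_one_mul, ← Complex.exp_pi_mul_I, ← Complex.exp_add,
    Complex.exp_eq_exp_iff_exists_int]
  refine ⟨p, ?_⟩
  push_cast
  ring

/-- Addition formula expressing a product of two theta values through theta series with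
doubled modulus. -/
lemma theta_add_mul_theta_sub {τ : ℂ} (hτ : 0 < τ.im) (x y : ℂ) :
    theta τ (x + y) * theta τ (x - y) =
      (∑' p, evenTerm τ x p) * (∑' p, oddTerm τ y p) -
        (∑' p, oddTerm τ x p) * (∑' p, evenTerm τ y p) := by
  have hprod {f g : ℤ → ℂ} (hf : Summable f) (hg : Summable g) :
      HasSum (fun p : ℤ × ℤ => f p.1 * g p.2) ((∑' p, f p) * ∑' p, g p) :=
    hf.hasSum.mul hg.hasSum (summable_mul_of_summable_norm hf.norm hg.norm)
  have h := hprod (summable_thetaTerm hτ (x + y)) (summable_thetaTerm hτ (x - y))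
  have h1 := hprod (summable_evenTerm hτ x) (summable_oddTerm hτ y)
  have h2 := (hprod (summable_oddTerm hτ x) (summable_evenTerm hτ y)).neg
  simp only [← thetaTerm_mul_thetaTerm_inl τ x y] at h1
  simp only [← thetaTerm_mul_thetaTerm_inr τ x y] at h2
  rw [← pairParityEquiv.hasSum_iff] at h
  have h3 := h.unique (HasSum.sum (f := _ ∘ pairParityEquiv) h1 h2)
  have htheta (z : ℂ) : theta τ z = -∑' p, thetaTerm τ z p := rfl
  rw [htheta, htheta, neg_mul_neg, h3, ← sub_eq_add_neg]

lemma theta_neg {τ : ℂ} (hτ : 0 < τ.im) (z : ℂ) : theta τ (-z) = -theta τ z := by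
  have key (w : ℂ) : theta τ w * (theta τ z + theta τ (-z)) = 0 := by
    have h1 := theta_add_mul_theta_sub hτ ((w + z) / 2) ((w - z) / 2)
    have h2 := theta_add_mul_theta_sub hτ ((w - z) / 2) ((w + z) / 2)
    rw [show (w + z) / 2 + (w - z) / 2 = w by ring,
      show (w + z) / 2 - (w - z) / 2 = z by ring] at h1
    rw [show (w - z) / 2 + (w + z) / 2 = w by ring,
      show (w - z) / 2 - (w + z) / 2 = -z by ring] at h2
    linear_combination h1 + h2
  have h : (theta τ z + theta τ (-z)) ^ 2 = 0 := by linear_combination key z + key (-z)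
  linear_combination pow_eq_zero_iff two_ne_zero |>.mp h

lemma theta_zero {τ : ℂ} (hτ : 0 < τ.im) : theta τ 0 = 0 := by
  have h := theta_neg hτ 0
  rw [neg_zero] at h
  linear_combination h / 2

/-- Weierstrass' three-term identity. -/
lemma theta_three_term {τ : ℂ} (hτ : 0 < τ.im) (x y u v : ℂ) :
    theta τ (x + y) * theta τ (x - y) * (theta τ (u + v) * theta τ (u - v)) +
      theta τ (x + u) * theta τ (x - u) * (theta τ (v + y) * theta τ (v - y)) +
      theta τ (x + v) * theta τ (x - v) * (theta τ (y + u) * theta τ (y - u)) = 0 := by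
  simp only [theta_add_mul_theta_sub hτ]
  ring

lemma theta_six_product {τ : ℂ} (hτ : 0 < τ.im) (x y w u : ℂ) :
    theta τ (x + y) * theta τ (x + (w + u)) * theta τ (y + u) * theta τ w =
      theta τ y * theta τ (x + y + u) * theta τ (x + w) * theta τ (w + u) -
        theta τ x * theta τ (y - w) * theta τ (x + y + (w + u)) * theta τ u := by
  have h := theta_three_term hτ ((x + y + w) / 2) ((x + y - w) / 2) ((x + y + w) / 2 + u)
    ((x - y + w) / 2)
  rw [show (x + y + w) / 2 + (x + y - w) / 2 = x + y by ring,
    show (x + y + w) / 2 - (x + y - w) / 2 = w by ring,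
    show (x + y + w) / 2 + u + (x - y + w) / 2 = x + (w + u) by ring,
    show (x + y + w) / 2 + u - (x - y + w) / 2 = y + u by ring,
    show (x + y + w) / 2 + ((x + y + w) / 2 + u) = x + y + (w + u) by ring,
    show (x + y + w) / 2 - ((x + y + w) / 2 + u) = -u by ring,
    show (x - y + w) / 2 + (x + y - w) / 2 = x by ring,
    show (x - y + w) / 2 - (x + y - w) / 2 = -(y - w) by ring,
    show (x + y + w) / 2 + (x - y + w) / 2 = x + w by ring,
    show (x + y + w) / 2 - (x - y + w) / 2 = y by ring,
    show (x + y - w) / 2 + ((x + y + w) / 2 + u) = x + y + u by ring,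
    show (x + y - w) / 2 - ((x + y + w) / 2 + u) = -(w + u) by ring] at h
  simp only [theta_neg hτ] at h
  linear_combination h

lemma theta_antisymm_product {τ : ℂ} (hτ : 0 < τ.im) (x y u v : ℂ) :
    theta τ x * theta τ y * theta τ (x + y + (u + v)) * theta τ (u - v) =
      theta τ u * theta τ (x + v) * theta τ (y + v) * theta τ (x + y + u) -
        theta τ v * theta τ (x + u) * theta τ (y + u) * theta τ (x + y + v) := by
  have h := theta_three_term hτ ((x + y) / 2) ((x - y) / 2) ((x + y) / 2 + u) ((x + y) / 2 + v)
  rw [show (x + y) / 2 + (x - y) / 2 = x by ring,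
    show (x + y) / 2 - (x - y) / 2 = y by ring,
    show (x + y) / 2 + u + ((x + y) / 2 + v) = x + y + (u + v) by ring,
    show (x + y) / 2 + u - ((x + y) / 2 + v) = u - v by ring,
    show (x + y) / 2 + ((x + y) / 2 + u) = x + y + u by ring,
    show (x + y) / 2 - ((x + y) / 2 + u) = -u by ring,
    show (x + y) / 2 + v + (x - y) / 2 = x + v by ring,
    show (x + y) / 2 + v - (x - y) / 2 = y + v by ring,
    show (x + y) / 2 + ((x + y) / 2 + v) = x + y + v by ring,
    show (x + y) / 2 - ((x + y) / 2 + v) = -v by ring,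
    show (x - y) / 2 + ((x + y) / 2 + u) = x + u by ring,
    show (x - y) / 2 - ((x + y) / 2 + u) = -(y + u) by ring] at h
  simp only [theta_neg hτ] at h
  linear_combination h

lemma theta_shift_product_sub {τ : ℂ} (hτ : 0 < τ.im) (γ u v : ℂ) :
    theta τ (u + γ) * theta τ (u - γ) * theta τ v ^ 2 -
        theta τ (v + γ) * theta τ (v - γ) * theta τ u ^ 2 =
      theta τ (u + v) * theta τ (u - v) * theta τ γ ^ 2 := by
  have h := theta_three_term hτ u γ v 0
  rw [add_zero, sub_zero, add_zero, sub_zero, zero_add, zero_sub, theta_neg hτ γ,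
    add_comm γ v, ← neg_sub v γ, theta_neg hτ (v - γ)] at h
  linear_combination h

lemma beta_alpha_beta_exchange {τ : ℂ} (hτ : 0 < τ.im) {γ x y w u : ℂ}
    (hx : theta τ (x - γ) ≠ 0) (hy : theta τ (y - γ) ≠ 0) (hxy : theta τ (x + y - γ) ≠ 0)
    (hw : theta τ w ≠ 0) (hu : theta τ u ≠ 0) (hwu : theta τ (w + u) ≠ 0) :
    betaF τ γ x (w + u) * alphaF τ γ (x + y) w * betaF τ γ y u =
      alphaF τ γ y w * betaF τ γ (x + y) u * betaF τ γ x w +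
        betaF τ γ y (-w) * betaF τ γ (x + y) (w + u) * alphaF τ γ x w := by
  simp only [alphaF, betaF, theta_neg hτ w, ← sub_eq_add_neg]
  field_simp
  linear_combination theta τ γ ^ 2 * theta τ (w + γ) * theta_six_product hτ x y w u

lemma alpha_mul_alpha_sub {τ : ℂ} (hτ : 0 < τ.im) {γ x y u v : ℂ}
    (hu : theta τ u ≠ 0) (hv : theta τ v ≠ 0) :
    alphaF τ γ x u * alphaF τ γ y (-u) - alphaF τ γ x (-v) * alphaF τ γ y v =
      theta τ x * theta τ y * theta τ (u + v) * theta τ (u - v) * theta τ γ ^ 2 /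
        (theta τ (x - γ) * theta τ (y - γ) * theta τ u ^ 2 * theta τ v ^ 2) := by
  have h := theta_shift_product_sub hτ γ u v
  simp only [alphaF, neg_add_eq_sub, ← neg_sub u γ, ← neg_sub v γ, theta_neg hτ]
  by_cases hx : theta τ (x - γ) = 0
  · simp [hx]
  by_cases hy : theta τ (y - γ) = 0
  · simp [hy]
  field_simp
  linear_combination theta τ x * theta τ y * h

lemma alpha_beta_alpha_exchange {τ : ℂ} (hτ : 0 < τ.im) {γ x y u v : ℂ}
    (hx : theta τ (x - γ) ≠ 0) (hy : theta τ (y - γ) ≠ 0) (hxy : theta τ (x + y - γ) ≠ 0)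
    (hu : theta τ u ≠ 0) (hv : theta τ v ≠ 0) (huv : theta τ (u + v) ≠ 0) :
    alphaF τ γ x u * betaF τ γ (x + y) (u + v) * alphaF τ γ y (-u) +
        betaF τ γ x u * betaF τ γ (x + y) v * betaF τ γ y u =
      alphaF τ γ x (-v) * betaF τ γ (x + y) (u + v) * alphaF τ γ y v +
        betaF τ γ x v * betaF τ γ (x + y) u * betaF τ γ y v := by
  suffices h : theta τ x * theta τ y * theta τ (u + v) * theta τ (u - v) * theta τ γ ^ 2 /
        (theta τ (x - γ) * theta τ (y - γ) * theta τ u ^ 2 * theta τ v ^ 2) *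
          betaF τ γ (x + y) (u + v) =
      betaF τ γ x v * betaF τ γ (x + y) u * betaF τ γ y v -
        betaF τ γ x u * betaF τ γ (x + y) v * betaF τ γ y u by
    rw [← alpha_mul_alpha_sub hτ hu hv] at h
    linear_combination h
  simp only [betaF]
  field_simp
  linear_combination -theta τ γ ^ 3 * theta_antisymm_product hτ x y u v

lemma betaF_eq_zero {τ γ : ℂ} (hγ : theta τ γ = 0) (z μ : ℂ) : betaF τ γ z μ = 0 := by
  simp [betaF, hγ]

lemma betaF_neg_step {τ : ℂ} (hτ : 0 < τ.im) {γ z : ℂ} (hγ : theta τ γ ≠ 0)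
    (hz : theta τ (z - γ) ≠ 0) : betaF τ γ z (-γ) = 1 := by
  rw [betaF, theta_neg hτ, ← sub_eq_add_neg]
  field_simp

lemma alphaF_neg_step {τ : ℂ} (hτ : 0 < τ.im) (γ z : ℂ) : alphaF τ γ z (-γ) = 0 := by
  rw [alphaF, neg_add_cancel, theta_zero hτ, mul_zero, zero_div]

lemma Rop_mulVec_single {N n : ℕ} (τ γ z : ℂ) (lam : Fin N → ℂ) (S : Finset (Fin n))
    {a b : Fin n} (hab : a ≠ b) (g : Fin n → Fin N) :
    Rop N n τ γ z lam S a b *ᵥ Pi.single g 1 =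
      if g a = g b then Pi.single g 1
      else alphaF τ γ z (shiftL γ lam S g (g a) - shiftL γ lam S g (g b)) • Pi.single g 1 +
        betaF τ γ z (shiftL γ lam S g (g b) - shiftL γ lam S g (g a)) •
          Pi.single (g ∘ Equiv.swap a b) 1 := by
  rw [Matrix.mulVec_single_one]
  ext f
  have h1 : f = g ↔ (∀ c, c ≠ a → c ≠ b → f c = g c) ∧ f a = g a ∧ f b = g b := by
    rw [funext_iff]
    grind
  have h2 : f = g ∘ Equiv.swap a b ↔
      (∀ c, c ≠ a → c ≠ b → f c = g c) ∧ f a = g b ∧ f b = g a := by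
    rw [funext_iff]
    simp only [Function.comp_apply, Equiv.swap_apply_def]
    grind
  by_cases hgab : g a = g b
  · rw [if_pos hgab, Matrix.col_apply, Rop, Rmat, Pi.single_apply]
    simp only [Prod.mk.injEq, h1]
    grind
  · rw [if_neg hgab, Matrix.col_apply, Rop, Rmat, Pi.add_apply, Pi.smul_apply, Pi.smul_apply,
      Pi.single_apply, Pi.single_apply]
    simp only [Prod.mk.injEq, h1, h2, smul_eq_mul]
    grind

/-- The basis vector `e_i ⊗ e_j ⊗ e_k` of `(ℂ^N)^{⊗3}`. -/
def tripleVec {N : ℕ} (i j k : Fin N) : (Fin 3 → Fin N) → ℂ := Pi.single ![i, j, k] 1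

lemma shiftL_empty {n N : ℕ} (γ : ℂ) (lam : Fin N → ℂ) (g : Fin n → Fin N) :
    shiftL γ lam ∅ g = lam := by
  ext i
  simp [shiftL]

lemma shiftL_singleton {n N : ℕ} (γ : ℂ) (lam : Fin N → ℂ) (c : Fin n) (g : Fin n → Fin N)
    (i : Fin N) : shiftL γ lam {c} g i = lam i - if g c = i then γ else 0 := by
  rw [shiftL, Finset.filter_singleton]
  split_ifs <;> simp

section TripleVec

variable {N : ℕ} (τ γ z : ℂ) (lam : Fin N → ℂ) (S : Finset (Fin 3)) (i j k : Fin N)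

lemma Rop_zero_one_mulVec :
    Rop N 3 τ γ z lam S 0 1 *ᵥ tripleVec i j k =
      if i = j then tripleVec i j k
      else alphaF τ γ z (shiftL γ lam S ![i, j, k] i - shiftL γ lam S ![i, j, k] j) •
          tripleVec i j k +
        betaF τ γ z (shiftL γ lam S ![i, j, k] j - shiftL γ lam S ![i, j, k] i) •
          tripleVec j i k := by
  have h : ![i, j, k] ∘ Equiv.swap 0 1 = ![j, i, k] := by
    ext c
    fin_cases c <;> rfl
  rw [tripleVec, Rop_mulVec_single τ γ z lam S (by decide), h]
  rfl

lemma Rop_zero_two_mulVec :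
    Rop N 3 τ γ z lam S 0 2 *ᵥ tripleVec i j k =
      if i = k then tripleVec i j k
      else alphaF τ γ z (shiftL γ lam S ![i, j, k] i - shiftL γ lam S ![i, j, k] k) •
          tripleVec i j k +
        betaF τ γ z (shiftL γ lam S ![i, j, k] k - shiftL γ lam S ![i, j, k] i) •
          tripleVec k j i := by
  have h : ![i, j, k] ∘ Equiv.swap 0 2 = ![k, j, i] := by
    ext c
    fin_cases c <;> rfl
  rw [tripleVec, Rop_mulVec_single τ γ z lam S (by decide), h]
  rfl

lemma Rop_one_two_mulVec :
    Rop N 3 τ γ z lam S 1 2 *ᵥ tripleVec i j k =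
      if j = k then tripleVec i j k
      else alphaF τ γ z (shiftL γ lam S ![i, j, k] j - shiftL γ lam S ![i, j, k] k) •
          tripleVec i j k +
        betaF τ γ z (shiftL γ lam S ![i, j, k] k - shiftL γ lam S ![i, j, k] j) •
          tripleVec i k j := by
  have h : ![i, j, k] ∘ Equiv.swap 1 2 = ![i, k, j] := by
    ext c
    fin_cases c <;> rfl
  rw [tripleVec, Rop_mulVec_single τ γ z lam S (by decide), h]
  rfl

end TripleVec

section Pair

variable {τ γ x y m : ℂ}

lemma alphaF_mul_comm (τ γ x y a b : ℂ) :
    alphaF τ γ x a * alphaF τ γ y b = alphaF τ γ y a * alphaF τ γ x b := by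
  simp only [alphaF]
  ring

lemma alpha_alpha_add_beta_beta_beta (hτ : 0 < τ.im)
    (hx : theta τ (x - γ) ≠ 0) (hy : theta τ (y - γ) ≠ 0) (hxy : theta τ (x + y - γ) ≠ 0)
    (hm : theta τ m ≠ 0) (hmγ : theta τ (m - γ) ≠ 0) :
    alphaF τ γ y (γ - m) * alphaF τ γ x (m - γ) +
        betaF τ γ y (m - γ) * (betaF τ γ (x + y) (-m) * betaF τ γ x (m - γ)) =
      alphaF τ γ x m * alphaF τ γ y (-m) +
        betaF τ γ x (-m) * (betaF τ γ (x + y) (m - γ) * betaF τ γ y (-m)) := by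
  have hm' : theta τ (-m) ≠ 0 := by rwa [theta_neg hτ, neg_ne_zero]
  by_cases hγ : theta τ γ = 0
  · have h := alpha_mul_alpha_sub (γ := γ) (x := x) (y := y) hτ hmγ hm'
    simp only [hγ, neg_sub, neg_neg] at h
    simp only [betaF_eq_zero hγ]
    linear_combination h
  · have huv : m - γ + -m = -γ := by ring
    have h := alpha_beta_alpha_exchange hτ hx hy hxy hmγ hm'
      (by rwa [huv, theta_neg hτ, neg_ne_zero])
    rw [huv, betaF_neg_step hτ hγ hxy, neg_sub, neg_neg] at h
    linear_combination h

lemma alpha_beta_alpha_add_beta_beta (hτ : 0 < τ.im)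
    (hx : theta τ (x - γ) ≠ 0) (hy : theta τ (y - γ) ≠ 0) (hxy : theta τ (x + y - γ) ≠ 0)
    (hm : theta τ m ≠ 0) (hmγ : theta τ (m - γ) ≠ 0) :
    alphaF τ γ x (-m) * (betaF τ γ (x + y) (m - γ) * alphaF τ γ y m) +
        betaF τ γ x m * betaF τ γ y m = betaF τ γ (x + y) m := by
  by_cases hγ : theta τ γ = 0
  · simp [betaF_eq_zero hγ]
  · have huv : -γ + m = m - γ := by ring
    have h := alpha_beta_alpha_exchange hτ hx hy hxy (u := -γ)
      (by rwa [theta_neg hτ, neg_ne_zero]) hm (by rwa [huv])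
    rw [huv, betaF_neg_step hτ hγ hx, betaF_neg_step hτ hγ hy, betaF_neg_step hτ hγ hxy,
      alphaF_neg_step hτ] at h
    linear_combination -h

lemma alpha_beta_beta_add_beta_alpha (hτ : 0 < τ.im)
    (hx : theta τ (x - γ) ≠ 0) (hy : theta τ (y - γ) ≠ 0) (hxy : theta τ (x + y - γ) ≠ 0)
    (hm : theta τ m ≠ 0) (hmγ : theta τ (m - γ) ≠ 0) :
    alphaF τ γ y (m - γ) * (betaF τ γ (x + y) (-m) * betaF τ γ x (m - γ)) +
        betaF τ γ y (γ - m) * alphaF τ γ x (m - γ) =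
      alphaF τ γ (x + y) (m - γ) * betaF τ γ y (-m) := by
  by_cases hγ : theta τ γ = 0
  · simp [betaF_eq_zero hγ]
  · have hwu : m - γ + -m = -γ := by ring
    have h := beta_alpha_beta_exchange hτ hx hy hxy hmγ (u := -m)
      (by rwa [theta_neg hτ, neg_ne_zero]) (by rwa [hwu, theta_neg hτ, neg_ne_zero])
    rw [hwu, betaF_neg_step hτ hγ hx, betaF_neg_step hτ hγ hxy, neg_sub] at h
    linear_combination -h

lemma alpha_beta_add_beta_beta_alpha (hτ : 0 < τ.im)
    (hx : theta τ (x - γ) ≠ 0) (hy : theta τ (y - γ) ≠ 0) (hxy : theta τ (x + y - γ) ≠ 0)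
    (hm : theta τ m ≠ 0) (hmγ : theta τ (m - γ) ≠ 0) :
    betaF τ γ y (m - γ) * alphaF τ γ (x + y) m =
      alphaF τ γ x m * betaF τ γ y m +
        betaF τ γ x (-m) * (betaF τ γ (x + y) (m - γ) * alphaF τ γ y m) := by
  by_cases hγ : theta τ γ = 0
  · simp [betaF_eq_zero hγ]
  · have hwu : m + -γ = m - γ := by ring
    have h := beta_alpha_beta_exchange hτ hy hx (by rwa [add_comm y x]) hm (u := -γ)
      (by rwa [theta_neg hτ, neg_ne_zero]) (by rwa [hwu])
    rw [hwu, add_comm y x, betaF_neg_step hτ hγ hx, betaF_neg_step hτ hγ hxy] at h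
    linear_combination h

end Pair

section Columns

variable {N : ℕ} {τ γ x y : ℂ} {lam : Fin N → ℂ}

lemma dynamical_Yang_Baxter_column_of_pairwise_ne (hτ : 0 < τ.im)
    (hx : theta τ (x - γ) ≠ 0) (hy : theta τ (y - γ) ≠ 0) (hxy : theta τ (x + y - γ) ≠ 0)
    (hlam : ∀ i j : Fin N, i ≠ j → theta τ (lam i - lam j) ≠ 0)
    {i j k : Fin N} (hij : i ≠ j) (hik : i ≠ k) (hjk : j ≠ k) :
    Rop N 3 τ γ x lam {2} 0 1 *ᵥ (Rop N 3 τ γ (x + y) lam ∅ 0 2 *ᵥ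
        (Rop N 3 τ γ y lam {0} 1 2 *ᵥ tripleVec i j k)) =
      Rop N 3 τ γ y lam ∅ 1 2 *ᵥ (Rop N 3 τ γ (x + y) lam {1} 0 2 *ᵥ
        (Rop N 3 τ γ x lam ∅ 0 1 *ᵥ tripleVec i j k)) := by
  simp [Rop_zero_one_mulVec, Rop_zero_two_mulVec, Rop_one_two_mulVec, shiftL_empty,
    shiftL_singleton, mulVec_add, mulVec_smul, hij, hik, hjk, hij.symm, hik.symm, hjk.symm,
    -smul_add]
  have hadd (a b c : Fin N) : lam a - lam b + (lam b - lam c) = lam a - lam c := by ring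
  match_scalars
  · ring
  · linear_combination betaF τ γ x (lam j - lam i) *
      alphaF_mul_comm τ γ y (x + y) (lam j - lam k) (lam i - lam k)
  · have h := alpha_beta_alpha_exchange hτ hx hy hxy (hlam k j hjk.symm) (hlam j i hij.symm)
      (by rw [hadd]; exact hlam k i hik.symm)
    rw [hadd, neg_sub, neg_sub] at h
    linear_combination h
  · have h := beta_alpha_beta_exchange hτ hx hy hxy (hlam j k hjk) (hlam k i hik.symm)
      (by rw [hadd]; exact hlam j i hij.symm)
    rw [hadd, neg_sub] at h
    linear_combination -h
  · linear_combination betaF τ γ y (lam k - lam j) *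
      alphaF_mul_comm τ γ (x + y) x (lam i - lam j) (lam i - lam k)
  · have hadd' : lam i - lam j + (lam k - lam i) = lam k - lam j := by ring
    have h := beta_alpha_beta_exchange hτ hy hx (by rwa [add_comm y x]) (hlam i j hij)
      (hlam k i hik.symm) (by rw [hadd']; exact hlam k j hjk.symm)
    rw [hadd', neg_sub, add_comm y x] at h
    linear_combination h

variable {p q : Fin N}

lemma weight_differences (p q : Fin N) :
    lam q - lam p = -(lam p - lam q) ∧ lam p - γ - lam q = lam p - lam q - γ ∧
      lam q - (lam p - γ) = γ - (lam p - lam q) := by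
  refine ⟨?_, ?_, ?_⟩ <;> ring

lemma dynamical_Yang_Baxter_column_left_pair (hτ : 0 < τ.im)
    (hx : theta τ (x - γ) ≠ 0) (hy : theta τ (y - γ) ≠ 0) (hxy : theta τ (x + y - γ) ≠ 0)
    (hpq : p ≠ q) (hm : theta τ (lam p - lam q) ≠ 0) (hmγ : theta τ (lam p - lam q - γ) ≠ 0) :
    Rop N 3 τ γ x lam {2} 0 1 *ᵥ (Rop N 3 τ γ (x + y) lam ∅ 0 2 *ᵥ
        (Rop N 3 τ γ y lam {0} 1 2 *ᵥ tripleVec p p q)) =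
      Rop N 3 τ γ y lam ∅ 1 2 *ᵥ (Rop N 3 τ γ (x + y) lam {1} 0 2 *ᵥ
        (Rop N 3 τ γ x lam ∅ 0 1 *ᵥ tripleVec p p q)) := by
  obtain ⟨h1, h2, h3⟩ := weight_differences (γ := γ) (lam := lam) p q
  simp [Rop_zero_one_mulVec, Rop_zero_two_mulVec, Rop_one_two_mulVec, shiftL_empty,
    shiftL_singleton, mulVec_add, mulVec_smul, hpq, hpq.symm, -smul_add]
  rw [h1, h2, h3]
  generalize lam p - lam q = m at *
  have hm' : theta τ (γ - m - γ) ≠ 0 := by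
    rwa [sub_sub_cancel_left, theta_neg hτ, neg_ne_zero]
  have hmγ' : theta τ (γ - m) ≠ 0 := by rwa [← neg_sub, theta_neg hτ, neg_ne_zero]
  have hyx : theta τ (y + x - γ) ≠ 0 := by rwa [add_comm y x]
  have e1 : -(γ - m) = m - γ := neg_sub γ m
  have e2 : γ - m - γ = -m := sub_sub_cancel_left γ m
  match_scalars
  · linear_combination alphaF_mul_comm τ γ y (x + y) (m - γ) m
  · have h := alpha_beta_alpha_add_beta_beta hτ hy hx hyx hmγ' hm'
    simp only [e1, e2, add_comm y x] at h
    linear_combination h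
  · linear_combination alpha_beta_beta_add_beta_alpha hτ hx hy hxy hm hmγ

lemma dynamical_Yang_Baxter_column_outer_pair (hτ : 0 < τ.im)
    (hx : theta τ (x - γ) ≠ 0) (hy : theta τ (y - γ) ≠ 0) (hxy : theta τ (x + y - γ) ≠ 0)
    (hpq : p ≠ q) (hm : theta τ (lam p - lam q) ≠ 0) (hmγ : theta τ (lam p - lam q - γ) ≠ 0) :
    Rop N 3 τ γ x lam {2} 0 1 *ᵥ (Rop N 3 τ γ (x + y) lam ∅ 0 2 *ᵥ
        (Rop N 3 τ γ y lam {0} 1 2 *ᵥ tripleVec p q p)) =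
      Rop N 3 τ γ y lam ∅ 1 2 *ᵥ (Rop N 3 τ γ (x + y) lam {1} 0 2 *ᵥ
        (Rop N 3 τ γ x lam ∅ 0 1 *ᵥ tripleVec p q p)) := by
  obtain ⟨h1, h2, h3⟩ := weight_differences (γ := γ) (lam := lam) p q
  simp [Rop_zero_one_mulVec, Rop_zero_two_mulVec, Rop_one_two_mulVec, shiftL_empty,
    shiftL_singleton, mulVec_add, mulVec_smul, hpq, hpq.symm, -smul_add]
  rw [h1, h2, h3]
  generalize lam p - lam q = m at *
  have hm' : theta τ (γ - m - γ) ≠ 0 := by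
    rwa [sub_sub_cancel_left, theta_neg hτ, neg_ne_zero]
  have hmγ' : theta τ (γ - m) ≠ 0 := by rwa [← neg_sub, theta_neg hτ, neg_ne_zero]
  have hyx : theta τ (y + x - γ) ≠ 0 := by rwa [add_comm y x]
  have e1 : -(γ - m) = m - γ := neg_sub γ m
  have e2 : γ - m - γ = -m := sub_sub_cancel_left γ m
  match_scalars
  · linear_combination alpha_alpha_add_beta_beta_beta hτ hx hy hxy hm hmγ
  · have h := alpha_beta_add_beta_beta_alpha hτ hy hx hyx hmγ' hm'
    simp only [e1, e2, add_comm y x] at h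
    linear_combination -h
  · linear_combination alpha_beta_add_beta_beta_alpha hτ hx hy hxy hm hmγ

lemma dynamical_Yang_Baxter_column_right_pair (hτ : 0 < τ.im)
    (hx : theta τ (x - γ) ≠ 0) (hy : theta τ (y - γ) ≠ 0) (hxy : theta τ (x + y - γ) ≠ 0)
    (hpq : p ≠ q) (hm : theta τ (lam p - lam q) ≠ 0) (hmγ : theta τ (lam p - lam q - γ) ≠ 0) :
    Rop N 3 τ γ x lam {2} 0 1 *ᵥ (Rop N 3 τ γ (x + y) lam ∅ 0 2 *ᵥ
        (Rop N 3 τ γ y lam {0} 1 2 *ᵥ tripleVec q p p)) =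
      Rop N 3 τ γ y lam ∅ 1 2 *ᵥ (Rop N 3 τ γ (x + y) lam {1} 0 2 *ᵥ
        (Rop N 3 τ γ x lam ∅ 0 1 *ᵥ tripleVec q p p)) := by
  obtain ⟨h1, h2, h3⟩ := weight_differences (γ := γ) (lam := lam) p q
  simp [Rop_zero_one_mulVec, Rop_zero_two_mulVec, Rop_one_two_mulVec, shiftL_empty,
    shiftL_singleton, mulVec_add, mulVec_smul, hpq, hpq.symm, -smul_add]
  rw [h1, h2, h3]
  generalize lam p - lam q = m at *
  have hm' : theta τ (γ - m - γ) ≠ 0 := by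
    rwa [sub_sub_cancel_left, theta_neg hτ, neg_ne_zero]
  have hmγ' : theta τ (γ - m) ≠ 0 := by rwa [← neg_sub, theta_neg hτ, neg_ne_zero]
  have hyx : theta τ (y + x - γ) ≠ 0 := by rwa [add_comm y x]
  have e1 : -(γ - m) = m - γ := neg_sub γ m
  have e2 : γ - m - γ = -m := sub_sub_cancel_left γ m
  match_scalars
  · linear_combination alphaF_mul_comm τ γ (x + y) x (-m) (γ - m)
  · have h := alpha_beta_beta_add_beta_alpha hτ hy hx hyx hmγ' hm'
    simp only [e1, e2, sub_sub_cancel, add_comm y x] at h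
    linear_combination -h
  · linear_combination -alpha_beta_alpha_add_beta_beta hτ hx hy hxy hm hmγ

end Columns

/-- the elliptic dynamical R-matrix satisfies the dynamical Yang–Baxter
equation on `ℂ^N ⊗ ℂ^N ⊗ ℂ^N`. -/
theorem dynamical_Yang_Baxter (N : ℕ) (hN : 2 ≤ N) (τ : ℂ) (hτ : 0 < τ.im)
    (γ z₁ z₂ z₃ : ℂ) (lam : Fin N → ℂ)
    (hz₁₂ : theta τ (z₁ - z₂ - γ) ≠ 0) (hz₁₃ : theta τ (z₁ - z₃ - γ) ≠ 0)
    (hz₂₃ : theta τ (z₂ - z₃ - γ) ≠ 0)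
    (hlam : ∀ i j : Fin N, i ≠ j →
      theta τ (lam i - lam j) ≠ 0 ∧ theta τ (lam i - lam j - γ) ≠ 0 ∧
        theta τ (lam i - lam j + γ) ≠ 0) :
    Rop N 3 τ γ (z₁ - z₂) lam {2} 0 1 * Rop N 3 τ γ (z₁ - z₃) lam ∅ 0 2 *
        Rop N 3 τ γ (z₂ - z₃) lam {0} 1 2 =
      Rop N 3 τ γ (z₂ - z₃) lam ∅ 1 2 * Rop N 3 τ γ (z₁ - z₃) lam {1} 0 2 *
        Rop N 3 τ γ (z₁ - z₂) lam ∅ 0 1 := by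
  have hadd : z₁ - z₃ = z₁ - z₂ + (z₂ - z₃) := by ring
  rw [hadd] at hz₁₃ ⊢
  refine Matrix.ext_of_mulVec_single fun g => ?_
  obtain ⟨i, j, k, rfl⟩ : ∃ i j k, g = ![i, j, k] := by
    refine ⟨g 0, g 1, g 2, ?_⟩
    ext c
    fin_cases c <;> rfl
  simp only [← mulVec_mulVec]
  by_cases hij : i = j
  · subst hij
    by_cases hik : i = k
    · subst hik
      change _ *ᵥ (_ *ᵥ (_ *ᵥ tripleVec i i i)) = _ *ᵥ (_ *ᵥ (_ *ᵥ tripleVec i i i))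
      simp [Rop_zero_one_mulVec, Rop_zero_two_mulVec, Rop_one_two_mulVec]
    · exact dynamical_Yang_Baxter_column_left_pair hτ hz₁₂ hz₂₃ hz₁₃ hik (hlam i k hik).1
        (hlam i k hik).2.1
  · by_cases hik : i = k
    · subst hik
      exact dynamical_Yang_Baxter_column_outer_pair hτ hz₁₂ hz₂₃ hz₁₃ hij (hlam i j hij).1
        (hlam i j hij).2.1
    · by_cases hjk : j = k
      · subst hjk
        exact dynamical_Yang_Baxter_column_right_pair hτ hz₁₂ hz₂₃ hz₁₃ (Ne.symm hij)
          (hlam j i (Ne.symm hij)).1 (hlam j i (Ne.symm hij)).2.1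
      · exact dynamical_Yang_Baxter_column_of_pairwise_ne hτ hz₁₂ hz₂₃ hz₁₃
          (fun a b hab => (hlam a b hab).1) hij hik hjk

end EllipticQG
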